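/- arXiv:1810.05256 — 6 statements merged into one kernel-verified Lean document; each statement's English description precedes it below -/
import Mathlib

section
/- In the Aleph poset model: if U₀, U₁, V₀, V₁ are units with U₁ high above U₀ (U₁ ≫ U₀) and V₁ high above V₀ (V₁ ≫ V₀), then U₁ ≥ V₀ or V₁ ≥ U₀. -/
open scoped Classical

/-- The number of distinct creators of units in `S` (the support count `#ₛS`). -/
noncomputable def suppCount {N : ℕ} {P : Type*} (c : P → Fin N) (S : Set P) : ℕ :=
  (c '' S).ncard

/-- `HighAbove c V U` means `V ≫ U`: `U ≤ V` and the units between `U` and `V`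
have at least `2N/3` distinct creators. -/
def HighAbove {N : ℕ} {P : Type*} [PartialOrder P] (c : P → Fin N) (V U : P) : Prop :=
  U ≤ V ∧ 2 * N ≤ 3 * suppCount c {W | U ≤ W ∧ W ≤ V}

/-- Two sets whose sizes add up to more than that of the ambient type plus that of the complement
of `C` share an element of `C`. -/
theorem Set.exists_mem_inter_of_card_add_card_compl_lt {α : Type*} [Fintype α]
    [DecidableEq α] (A B : Set α) (C : Finset α)
    (h : Fintype.card α + ((Finset.univ : Finset α) \ C).card < A.ncard + B.ncard) :
    ∃ x ∈ C, x ∈ A ∧ x ∈ B := by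
  by_contra! hAB
  have hsub : A ∩ B ⊆ ↑((Finset.univ : Finset α) \ C) := fun x hx ↦ by
    simpa using fun hC ↦ hAB x hC hx.1 hx.2
  have hinter := Set.ncard_le_ncard hsub (Set.toFinite _)
  rw [Set.ncard_coe_finset] at hinter
  have hunion : (A ∪ B).ncard ≤ Fintype.card α := by
    simpa [Nat.card_eq_fintype_card] using Set.ncard_le_card (A ∪ B)
  have hsum := Set.ncard_union_add_ncard_inter A B
  omega

/-- **Lemma 2.2 (quorum intersection for high-above pairs).** If `U₁ ≫ U₀` and `V₁ ≫ V₀`,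
then `U₁ ≥ V₀` or `V₁ ≥ U₀`. -/
theorem aleph_high_above_cross {P : Type*} [PartialOrder P] [Fintype P] {N : ℕ} (hN : 0 < N)
    (c : P → Fin N) (Correct : Finset (Fin N))
    (hfaulty : 3 * ((Finset.univ : Finset (Fin N)) \ Correct).card < N)
    (hchain : ∀ U V : P, c U = c V → c U ∈ Correct → U ≤ V ∨ V ≤ U)
    (U₀ U₁ V₀ V₁ : P)
    (hU : HighAbove c U₁ U₀) (hV : HighAbove c V₁ V₀) :
    V₀ ≤ U₁ ∨ U₀ ≤ V₁ := by
  obtain ⟨-, hU⟩ := hU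
  obtain ⟨-, hV⟩ := hV
  unfold suppCount at hU hV
  obtain ⟨x, hx, ⟨W, ⟨hUW, hWU⟩, rfl⟩, ⟨W', ⟨hVW', hWV'⟩, hc⟩⟩ :=
    Set.exists_mem_inter_of_card_add_card_compl_lt (c '' {W | U₀ ≤ W ∧ W ≤ U₁})
      (c '' {W | V₀ ≤ W ∧ W ≤ V₁}) Correct (by rw [Fintype.card_fin]; omega)
  rcases hchain W W' hc.symm hx with h | h
  · exact Or.inr (hUW.trans (h.trans hWV'))
  · exact Or.inl (hVW'.trans (h.trans hWU))
end

section
/- In the Aleph poset model with a level function L: if U and V are units with V ≫ U, then every unit W with L(W) ≥ L(V) + 2 satisfies W ≫ U (in particular U ≤ W). -/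
open scoped Classical

/-- A unit `U` is prime if no unit `V < U` with the same creator has the same level. -/
def IsPrime {N : ℕ} {P : Type*} [PartialOrder P] (c : P → Fin N) (L : P → ℕ) (U : P) : Prop :=
  ¬ ∃ V, V < U ∧ c V = c U ∧ L V = L U

/-- `L` is a level function: it is monotone and every unit `W` of level `≥ 1` is high above
prime units of level `L W - 1` created by at least `2N/3` distinct processes. -/
def IsLevelFn {N : ℕ} {P : Type*} [PartialOrder P] (c : P → Fin N) (L : P → ℕ) : Prop :=
  Monotone L ∧ ∀ W : P, 1 ≤ L W →
    2 * N ≤ 3 * suppCount c {X | HighAbove c W X ∧ L X = L W - 1 ∧ IsPrime c L X}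

/-- Two sets of units with at least `2N/3` distinct creators each share a correct creator. -/
lemma exists_common_correct_creator {P : Type*} {N : ℕ} (c : P → Fin N)
    (Correct : Finset (Fin N))
    (hfaulty : 3 * ((Finset.univ : Finset (Fin N)) \ Correct).card < N) (S T : Set P)
    (hS : 2 * N ≤ 3 * suppCount c S) (hT : 2 * N ≤ 3 * suppCount c T) :
    ∃ X ∈ S, ∃ Y ∈ T, c X = c Y ∧ c X ∈ Correct := by
  by_contra! h
  unfold suppCount at hS hT
  have hsub : c '' S ∩ c '' T ⊆ ((Finset.univ \ Correct : Finset (Fin N)) : Set (Fin N)) := by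
    rintro _ ⟨⟨X, hX, rfl⟩, Y, hY, hYX⟩
    simpa using h X hX Y hY hYX.symm
  have hinter := Set.ncard_le_ncard hsub (Set.toFinite _)
  rw [Set.ncard_coe_finset] at hinter
  have hunion : (c '' S ∪ c '' T).ncard ≤ N := by
    simpa using Set.ncard_le_card (c '' S ∪ c '' T)
  have hsum := Set.ncard_union_add_ncard_inter (c '' S) (c '' T)
  omega

lemma suppCount_mono {P : Type*} {N : ℕ} (c : P → Fin N) {S T : Set P} (h : S ⊆ T) :
    suppCount c S ≤ suppCount c T :=
  Set.ncard_le_ncard (Set.image_mono h) (Set.toFinite _)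

lemma HighAbove.mono_left {P : Type*} [PartialOrder P] {N : ℕ} {c : P → Fin N} {U Y W : P}
    (h : HighAbove c W Y) (hUY : U ≤ Y) : HighAbove c W U :=
  ⟨hUY.trans h.1, h.2.trans <| Nat.mul_le_mul_left 3 <|
    suppCount_mono c fun _ hX => ⟨hUY.trans hX.1, hX.2⟩⟩

/-- **Lemma (two levels above).** If `V ≫ U`, then every unit `W` with
`L W ≥ L V + 2` satisfies `W ≫ U`. -/
theorem aleph_two_levels_above {P : Type*} [PartialOrder P] [Fintype P] {N : ℕ} (hN : 0 < N)
    (c : P → Fin N) (Correct : Finset (Fin N))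
    (hfaulty : 3 * ((Finset.univ : Finset (Fin N)) \ Correct).card < N)
    (hchain : ∀ U V : P, c U = c V → c U ∈ Correct → U ≤ V ∨ V ≤ U)
    (L : P → ℕ) (hL : IsLevelFn c L)
    (U V : P) (hVU : HighAbove c V U)
    (W : P) (hW : L V + 2 ≤ L W) :
    HighAbove c W U := by
  obtain ⟨T, hT, Y, hY, hTY, hcorrect⟩ := exists_common_correct_creator c Correct hfaulty
    _ _ hVU.2 (hL.2 W (by omega))
  refine hY.1.mono_left (hT.1.trans ?_)
  refine (hchain T Y hTY hcorrect).resolve_right fun hle => ?_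
  have hYV := hL.1 (hle.trans hT.2)
  have hlevel := hY.2.1
  omega
end

section
/- In the Aleph poset model with a level function L: let ℓ ≥ 1 and let S be a set of prime units, all of level ℓ − 1, with 3·#ₛS ≥ 2·N. Then every prime unit W of level ℓ is high above some unit X ∈ S whose creator c(X) is a correct process. -/
open scoped Classical

/-- Two sets of at least two thirds of `Fin N` meet in every set missing fewer than a third. -/
theorem exists_mem_of_two_thirds {N : ℕ} {A B C : Finset (Fin N)}
    (hA : 2 * N ≤ 3 * A.card) (hB : 2 * N ≤ 3 * B.card)
    (hC : 3 * ((Finset.univ : Finset (Fin N)) \ C).card < N) :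
    ∃ p ∈ C, p ∈ A ∧ p ∈ B := by
  by_contra! h
  have hsub : A ∩ B ⊆ Finset.univ \ C := fun p hp => by
    rw [Finset.mem_inter] at hp
    simpa using fun hpC => h p hpC hp.1 hp.2
  have hle := Finset.card_le_card hsub
  have hunion : (A ∪ B).card ≤ N := by simpa using Finset.card_le_univ (A ∪ B)
  have hadd := Finset.card_union_add_card_inter A B
  omega

/-- Comparable prime units with the same creator and level are equal. -/
theorem IsPrime.eq_of_comparable {N : ℕ} {P : Type*} [PartialOrder P] {c : P → Fin N}
    {L : P → ℕ} {U V : P} (hU : IsPrime c L U) (hV : IsPrime c L V)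
    (hc : c U = c V) (hL : L U = L V) (h : U ≤ V ∨ V ≤ U) : U = V := by
  by_contra hne
  rcases h with h | h
  · exact hV ⟨U, lt_of_le_of_ne h hne, hc, hL⟩
  · exact hU ⟨V, lt_of_le_of_ne h (Ne.symm hne), hc.symm, hL.symm⟩

/-- Every prime unit of level `ℓ` is high above some unit of any supermajority-supported
set `S` of prime units of level `ℓ - 1` whose creator is correct. -/
theorem aleph_high_above_correct_member {P : Type*} [PartialOrder P] [Fintype P] {N : ℕ} (hN : 0 < N)
    (c : P → Fin N) (Correct : Finset (Fin N))
    (hfaulty : 3 * ((Finset.univ : Finset (Fin N)) \ Correct).card < N)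
    (hchain : ∀ U V : P, c U = c V → c U ∈ Correct → U ≤ V ∨ V ≤ U)
    (L : P → ℕ) (hL : IsLevelFn c L)
    (ℓ : ℕ) (hℓ : 1 ≤ ℓ) (S : Set P)
    (hS : ∀ X ∈ S, IsPrime c L X ∧ L X = ℓ - 1)
    (hSsupp : 2 * N ≤ 3 * suppCount c S)
    (W : P) (hW : IsPrime c L W) (hWlev : L W = ℓ) :
    ∃ X ∈ S, c X ∈ Correct ∧ HighAbove c W X := by
  have hT := hL.2 W (hWlev ▸ hℓ)
  unfold suppCount at hT hSsupp
  rw [Set.ncard_eq_toFinset_card'] at hT hSsupp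
  obtain ⟨p, hp, hpS, hpT⟩ := exists_mem_of_two_thirds hSsupp hT hfaulty
  rw [Set.mem_toFinset] at hpS hpT
  obtain ⟨X, hX, rfl⟩ := hpS
  obtain ⟨Y, ⟨hWY, hYlev, hY⟩, hYX⟩ := hpT
  obtain ⟨hXprime, hXlev⟩ := hS X hX
  have hXY : X = Y := hXprime.eq_of_comparable hY hYX.symm
    (by rw [hXlev, hYlev, hWlev]) (hchain X Y hYX.symm hp)
  exact ⟨X, hX, hp, hXY ▸ hWY⟩
end

section
/- (Finiteness of the decision procedure.) In the Aleph poset model with a level function L, candidate prime unit U_c, coin function, and functions Π, Δ satisfying the Aleph recurrences: fix k > 1 and let ℓ = L(U_c) + 2k. If Π(U) = some (coin(ℓ − 1)) for every prime unit U of level ℓ, then every prime unit V with L(V) ≥ ℓ + 2 satisfies Δ(V) ≠ none. -/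
open scoped Classical

/-- The set `⇓U` of prime ancestors of `U`: prime units of level `L U - 1` high below `U`. -/
def primeAnc {N : ℕ} {P : Type*} [PartialOrder P] (c : P → Fin N) (L : P → ℕ) (U : P) :
    Set P :=
  {W | IsPrime c L W ∧ HighAbove c U W ∧ L W = L U - 1}

/-- The supermajority operator. -/
noncomputable def SupMaj {N : ℕ} {P : Type*} (c : P → Fin N) (S : Set P)
    (f : P → Option Bool) : Option Bool :=
  if 2 * N ≤ 3 * suppCount c {U ∈ S | f U = some true} then some true
  else if 2 * N ≤ 3 * suppCount c {U ∈ S | f U = some false} then some false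
  else none

/-- The existence operator (with preference for `true`). -/
noncomputable def ExistOp {P : Type*} (S : Set P) (f : P → Option Bool) : Option Bool :=
  if ∃ U ∈ S, f U = some true then some true
  else if ∃ U ∈ S, f U = some false then some false
  else none

/-- The randomized existence operator: as `ExistOp`, but falling back to the threshold coin.
Here `ℓ` is the level of the unit whose prime ancestors form `S` (so units of `S` have
level `ℓ - 1`, and the coin with nonce `ℓ - 1` is used). -/
noncomputable def ExistTC {P : Type*} (coin : ℕ → Bool) (S : Set P)
    (f : P → Option Bool) (ℓ : ℕ) : Option Bool :=
  match ExistOp S f with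
  | none => some (coin (ℓ - 1))
  | some b => some b

/-- The round type of a prime unit `U` relative to the candidate `Uc`:
`none` (⊥) for preliminary rounds, `some 0` for even and `some 1` for odd rounds. -/
def roundType {P : Type*} [PartialOrder P] (L : P → ℕ) (Uc U : P) : Option ℕ :=
  if L U ≤ L Uc + 1 then none else some ((L U - L Uc) % 2)

/-- The Aleph recurrences for the proposal function `Pi` and the decision function `Delta`
with respect to the candidate prime unit `Uc` and the threshold coin `coin`. -/
def AlephRec {N : ℕ} {P : Type*} [PartialOrder P] (c : P → Fin N) (L : P → ℕ)
    (Uc : P) (coin : ℕ → Bool) (Pi Delta : P → Option Bool) : Prop :=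
  ∀ U : P, IsPrime c L U →
    (roundType L Uc U = none →
      Pi U = some (decide (Uc ≤ U)) ∧ Delta U = none) ∧
    (roundType L Uc U = some 1 →
      Pi U = SupMaj c (primeAnc c L U) Pi ∧ Delta U = ExistOp (primeAnc c L U) Delta) ∧
    (roundType L Uc U = some 0 →
      Pi U = ExistTC coin (primeAnc c L U) Pi (L U) ∧ Delta U = SupMaj c (primeAnc c L U) Pi)

lemma IsLevelFn.two_mul_le_suppCount_primeAnc {N : ℕ} {P : Type*} [PartialOrder P]
    {c : P → Fin N} {L : P → ℕ} (hL : IsLevelFn c L) {U : P} (hU : 1 ≤ L U) :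
    2 * N ≤ 3 * suppCount c (primeAnc c L U) := by
  have h : primeAnc c L U = {X | HighAbove c U X ∧ L X = L U - 1 ∧ IsPrime c L X} := by
    ext X
    simp only [primeAnc, Set.mem_ofPred_eq]
    tauto
  rw [h]
  exact hL.2 U hU

lemma nonempty_of_two_mul_le_suppCount {N : ℕ} {P : Type*} (hN : 0 < N) {c : P → Fin N}
    {S : Set P} (hS : 2 * N ≤ 3 * suppCount c S) : S.Nonempty := by
  rw [Set.nonempty_iff_ne_empty]
  rintro rfl
  simp only [suppCount, Set.image_empty, Set.ncard_empty] at hS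
  omega

lemma SupMaj_eq_some_of_forall {N : ℕ} {P : Type*} (hN : 0 < N) {c : P → Fin N} {S : Set P}
    {f : P → Option Bool} {b : Bool} (hS : 2 * N ≤ 3 * suppCount c S)
    (hf : ∀ U ∈ S, f U = some b) : SupMaj c S f = some b := by
  have hb : {U ∈ S | f U = some b} = S := Set.sep_eq_self_iff_mem_true.2 hf
  cases b with
  | true => simp [SupMaj, hb, hS]
  | false =>
    have ht : ¬ 2 * N ≤ 3 * suppCount c {U ∈ S | f U = some true} := fun h ↦ by
      obtain ⟨U, hU, hUt⟩ := nonempty_of_two_mul_le_suppCount hN h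
      simp [hf U hU] at hUt
    rw [SupMaj, if_neg ht, hb, if_pos hS]

lemma ExistOp_eq_some_of_forall {P : Type*} {S : Set P} {f : P → Option Bool} {b : Bool}
    (hS : S.Nonempty) (hf : ∀ U ∈ S, f U = some b) : ExistOp S f = some b := by
  obtain ⟨U, hU⟩ := hS
  cases b with
  | true => exact if_pos ⟨U, hU, hf U hU⟩
  | false =>
    have ht : ¬ ∃ U ∈ S, f U = some true := by
      rintro ⟨W, hW, hWt⟩
      simp [hf W hW] at hWt
    rw [ExistOp, if_neg ht, if_pos ⟨U, hU, hf U hU⟩]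

lemma ExistOp_ne_none {P : Type*} {S : Set P} {f : P → Option Bool} {U : P} (hU : U ∈ S)
    (hf : f U ≠ none) : ExistOp S f ≠ none := by
  obtain ⟨b, hb⟩ := Option.ne_none_iff_exists'.1 hf
  unfold ExistOp
  split_ifs with ht hff
  · simp
  · simp
  · cases b with
    | true => exact (ht ⟨U, hU, hb⟩).elim
    | false => exact (hff ⟨U, hU, hb⟩).elim

lemma roundType_eq_some_mod {P : Type*} [PartialOrder P] {L : P → ℕ} {Uc U : P}
    (h : L Uc + 2 ≤ L U) : roundType L Uc U = some ((L U - L Uc) % 2) :=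
  if_neg (by omega)

/-- Once all prime units of a level past the preliminary rounds propose `b`, so do all prime
units of higher levels. -/
lemma AlephRec.proposal_eq_of_forall {P : Type*} [PartialOrder P] {N : ℕ} (hN : 0 < N)
    {c : P → Fin N} {L : P → ℕ} (hL : IsLevelFn c L) {Uc : P} {coin : ℕ → Bool}
    {Pi Delta : P → Option Bool} (hrec : AlephRec c L Uc coin Pi Delta) {ℓ : ℕ}
    (hℓ : L Uc + 2 ≤ ℓ) {b : Bool} (hPi : ∀ U, IsPrime c L U → L U = ℓ → Pi U = some b)
    {U : P} (hU : IsPrime c L U) (hlev : ℓ ≤ L U) : Pi U = some b := by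
  obtain ⟨n, hn⟩ : ∃ n, L U = n := ⟨_, rfl⟩
  rw [hn] at hlev
  induction n, hlev using Nat.le_induction generalizing U with
  | base => exact hPi U hU hn
  | succ n hle ih =>
    have hf : ∀ W ∈ primeAnc c L U, Pi W = some b :=
      fun W hW ↦ ih hW.1 (by rw [hW.2.2, hn, Nat.add_sub_cancel])
    have hS := hL.two_mul_le_suppCount_primeAnc (U := U) (by omega)
    have hrt := roundType_eq_some_mod (L := L) (Uc := Uc) (U := U) (by omega)
    rcases Nat.mod_two_eq_zero_or_one (L U - L Uc) with h | h <;> rw [h] at hrt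
    · rw [((hrec U hU).2.2 hrt).1, ExistTC,
        ExistOp_eq_some_of_forall (nonempty_of_two_mul_le_suppCount hN hS) hf]
    · rw [((hrec U hU).2.1 hrt).1, SupMaj_eq_some_of_forall hN hS hf]

/-- **Finiteness of the decision procedure.** If for `ℓ = L Uc + 2k` (with `k > 1`) every
prime unit of level `ℓ` has `Π` equal to the coin value `coin (ℓ - 1)`, then every prime
unit of level at least `ℓ + 2` is decided. -/
theorem aleph_finiteness_of_decision {P : Type*} [PartialOrder P] [Fintype P] {N : ℕ} (hN : 0 < N)
    (c : P → Fin N) (Correct : Finset (Fin N))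
    (hfaulty : 3 * ((Finset.univ : Finset (Fin N)) \ Correct).card < N)
    (hchain : ∀ U V : P, c U = c V → c U ∈ Correct → U ≤ V ∨ V ≤ U)
    (L : P → ℕ) (hL : IsLevelFn c L)
    (Uc : P) (hUc : IsPrime c L Uc) (coin : ℕ → Bool)
    (Pi Delta : P → Option Bool) (hrec : AlephRec c L Uc coin Pi Delta)
    (k : ℕ) (hk : 1 < k)
    (hPi : ∀ U : P, IsPrime c L U → L U = L Uc + 2 * k →
      Pi U = some (coin (L Uc + 2 * k - 1)))
    (V : P) (hV : IsPrime c L V) (hlev : L Uc + 2 * k + 2 ≤ L V) :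
    Delta V ≠ none := by
  have hprop : ∀ U, IsPrime c L U → L Uc + 2 * k ≤ L U →
      Pi U = some (coin (L Uc + 2 * k - 1)) :=
    fun U hU h ↦ hrec.proposal_eq_of_forall hN hL (by omega) hPi hU h
  have heven : ∀ U, IsPrime c L U → L Uc + 2 * k + 1 ≤ L U → (L U - L Uc) % 2 = 0 →
      Delta U ≠ none := by
    intro U hU h hmod
    have hrt := roundType_eq_some_mod (L := L) (Uc := Uc) (U := U) (by omega)
    rw [hmod] at hrt
    have hS := hL.two_mul_le_suppCount_primeAnc (U := U) (by omega)
    rw [((hrec U hU).2.2 hrt).2, SupMaj_eq_some_of_forall hN hS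
      fun W hW ↦ hprop W hW.1 (by rw [hW.2.2]; omega)]
    simp
  rcases Nat.mod_two_eq_zero_or_one (L V - L Uc) with h | h
  · exact heven V hV (by omega) h
  · have hrt := roundType_eq_some_mod (L := L) (Uc := Uc) (U := V) (by omega)
    rw [h] at hrt
    obtain ⟨W, hW⟩ := nonempty_of_two_mul_le_suppCount hN
      (hL.two_mul_le_suppCount_primeAnc (U := V) (by omega))
    have hWlev := hW.2.2
    rw [((hrec V hV).2.1 hrt).2]
    exact ExistOp_ne_none hW (heven W hW.1 (by omega) (by omega))
end

section
/- In the Aleph poset model with a level function L: let U₁ be a prime unit with L(U₁) = l + 1 (l ≥ 0) such that there is no other prime unit V < U₁ with L(V) = l + 1. Then for every U_c ∈ ⇓U₁ and every prime unit U₂ with L(U₂) = l + 2, U₂ is high above U_c (U₂ ≫ U_c). -/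
open scoped Classical

/-- Two supports of size at least `2N/3` share a correct creator. -/
theorem exists_correct_mem_inter {N : ℕ} {P : Type*} (c : P → Fin N) (Correct : Finset (Fin N))
    (hfaulty : 3 * ((Finset.univ : Finset (Fin N)) \ Correct).card < N) {S T : Set P}
    (hS : 2 * N ≤ 3 * suppCount c S) (hT : 2 * N ≤ 3 * suppCount c T) :
    ∃ U ∈ S, ∃ V ∈ T, c U = c V ∧ c U ∈ Correct := by
  by_contra! h
  have hsub : c '' S ∩ c '' T ⊆ ((Finset.univ \ Correct : Finset (Fin N)) : Set (Fin N)) := by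
    rintro _ ⟨⟨U, hU, rfl⟩, V, hV, hVU⟩
    simpa using h U hU V hV hVU.symm
  have hinter := Set.ncard_le_ncard hsub (Set.toFinite _)
  rw [Set.ncard_coe_finset] at hinter
  have hunion : (c '' S ∪ c '' T).ncard ≤ N := by
    simpa using Set.ncard_le_card (c '' S ∪ c '' T)
  have hadd := Set.ncard_union_add_ncard_inter (c '' S) (c '' T)
  unfold suppCount at hS hT
  omega

/-- If `U` lies below `V` and `W` is high above `V`, then `W` is high above `U`. -/
theorem HighAbove.of_le {N : ℕ} {P : Type*} [PartialOrder P] {c : P → Fin N} {U V W : P}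
    (h : HighAbove c W V) (hUV : U ≤ V) : HighAbove c W U := by
  have hsub : c '' {X | V ≤ X ∧ X ≤ W} ⊆ c '' {X | U ≤ X ∧ X ≤ W} :=
    Set.image_mono fun _ hX => ⟨hUV.trans hX.1, hX.2⟩
  exact ⟨hUV.trans h.1, h.2.trans (Nat.mul_le_mul_left 3 (Set.ncard_le_ncard hsub))⟩

/-- If `U₁` is a prime unit of level `l + 1` with no other prime unit of that level below
it, then every prime unit of level `l + 2` is high above every `Uc ∈ ⇓U₁`. -/
theorem aleph_level_plus_two_high_above {P : Type*} [PartialOrder P] [Fintype P] {N : ℕ} (hN : 0 < N)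
    (c : P → Fin N) (Correct : Finset (Fin N))
    (hfaulty : 3 * ((Finset.univ : Finset (Fin N)) \ Correct).card < N)
    (hchain : ∀ U V : P, c U = c V → c U ∈ Correct → U ≤ V ∨ V ≤ U)
    (L : P → ℕ) (hL : IsLevelFn c L)
    (l : ℕ) (U₁ : P) (hU₁ : IsPrime c L U₁) (hU₁lev : L U₁ = l + 1)
    (honly : ∀ V : P, IsPrime c L V → V < U₁ → L V ≠ l + 1)
    (Uc : P) (hUc : Uc ∈ primeAnc c L U₁)
    (U₂ : P) (hU₂ : IsPrime c L U₂) (hU₂lev : L U₂ = l + 2) :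
    HighAbove c U₂ Uc := by
  obtain ⟨W, ⟨hUcW, hWU₁⟩, X, ⟨hXU₂, hXlev, hXprime⟩, hWX, hcor⟩ :=
    exists_correct_mem_inter c Correct hfaulty hUc.2.1.2 (hL.2 U₂ (by omega))
  refine hXU₂.of_le ?_
  rcases hchain W X hWX hcor with h | h
  · exact hUcW.trans h
  · rcases (h.trans hWU₁).eq_or_lt with rfl | hlt
    · exact hUc.2.1.1
    · exact absurd (by omega) (honly X hXprime hlt)
end

section
/- (No two forking units can both be validated.) In the Aleph poset model: let U₀ and U₁ be forking units, i.e., U₀ ≠ U₁, c(U₀) = c(U₁), and neither U₀ ≤ U₁ nor U₁ ≤ U₀. Then there do not exist units V₀ and V₁ such that V₀ ≫ U₀ with ¬(U₁ ≤ V₀) and V₁ ≫ U₁ with ¬(U₀ ≤ V₁); that is, U₀ and U₁ cannot both have validators. -/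
open scoped Classical

/-- Two sets of at least two thirds of the processes share a member of any set whose complement
has fewer than a third of the processes. -/
theorem exists_mem_inter_of_two_thirds {N : ℕ} (C : Finset (Fin N))
    (hC : 3 * ((Finset.univ : Finset (Fin N)) \ C).card < N) {A B : Set (Fin N)}
    (hA : 2 * N ≤ 3 * A.ncard) (hB : 2 * N ≤ 3 * B.ncard) :
    ∃ i ∈ C, i ∈ A ∧ i ∈ B := by
  by_contra! h
  have hsub : A ∩ B ⊆ ((Finset.univ \ C : Finset (Fin N)) : Set (Fin N)) := by
    rintro i ⟨hiA, hiB⟩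
    simpa using fun hi => h i hi hiA hiB
  have hinter := Set.ncard_le_ncard hsub
  rw [Set.ncard_coe_finset] at hinter
  have hunion : (A ∪ B).ncard ≤ N := by
    simpa using Set.ncard_le_card (A ∪ B)
  have hsum := Set.ncard_union_add_ncard_inter A B
  omega

/-- **No two forking units can both be validated.** If `U₀` and `U₁` are forking units
(distinct, incomparable, same creator), then they cannot both have validators. -/
theorem aleph_no_two_forks_validated {P : Type*} [PartialOrder P] [Fintype P] {N : ℕ} (hN : 0 < N)
    (c : P → Fin N) (Correct : Finset (Fin N))
    (hfaulty : 3 * ((Finset.univ : Finset (Fin N)) \ Correct).card < N)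
    (hchain : ∀ U V : P, c U = c V → c U ∈ Correct → U ≤ V ∨ V ≤ U)
    (U₀ U₁ : P) (hne : U₀ ≠ U₁) (hfork : c U₀ = c U₁)
    (h01 : ¬ U₀ ≤ U₁) (h10 : ¬ U₁ ≤ U₀) :
    ¬ ∃ V₀ V₁ : P,
        (HighAbove c V₀ U₀ ∧ ¬ U₁ ≤ V₀) ∧ (HighAbove c V₁ U₁ ∧ ¬ U₀ ≤ V₁) := by
  rintro ⟨V₀, V₁, ⟨⟨-, hs₀⟩, hU₁⟩, ⟨-, hs₁⟩, hU₀⟩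
  obtain ⟨i, hi, ⟨W₀, ⟨hUW₀, hWV₀⟩, rfl⟩, W₁, ⟨hUW₁, hWV₁⟩, hc⟩ :=
    exists_mem_inter_of_two_thirds Correct hfaulty hs₀ hs₁
  rcases hchain W₀ W₁ hc.symm hi with h | h
  · exact hU₀ (hUW₀.trans (h.trans hWV₁))
  · exact hU₁ (hUW₁.trans (h.trans hWV₀))
end
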